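/- Let k be a field and H a commutative Hopf algebra over k with bijective antipode. Assume that the category of left-right Yetter-Drinfeld modules over H satisfies condition (†), and that the coinvariants functor M ↦ M^{coH} from Yetter-Drinfeld modules to k-vector spaces is exact. Then every Yetter-Drinfeld module M that is finitely generated as a left H-module is a projective object in the category of Yetter-Drinfeld modules. -/

import Mathlib

/-!
Common definitions for formalizing "Semisimplicity of the categories of
Yetter-Drinfeld modules and Long dimodules" (Caenepeel, Guédénon).
-/

open TensorProduct

noncomputable section
namespace YDPaper

section RingPart

variable (k H : Type) [CommRing k] [Ring H] [HopfAlgebra k H]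

/-- `ρ : M →ₗ[k] M ⊗[k] H` is a (coassociative, counital) right `H`-comodule
structure on `M`. -/
def IsComod {M : Type} [AddCommGroup M] [Module k M] (ρ : M →ₗ[k] M ⊗[k] H) : Prop :=
  (∀ m : M, (TensorProduct.rid k M)
      ((LinearMap.lTensor M (Coalgebra.counit (R := k) (A := H))) (ρ m)) = m) ∧
  (∀ m : M, (TensorProduct.assoc k M H H) ((LinearMap.rTensor H ρ) (ρ m)) =
      (LinearMap.lTensor M (Coalgebra.comul (R := k) (A := H))) (ρ m))

/-- The iterated comultiplication `h ↦ (h₁ ⊗ h₂) ⊗ h₃`. -/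
def Delta2 : H →ₗ[k] (H ⊗[k] H) ⊗[k] H :=
  (LinearMap.rTensor H (Coalgebra.comul (R := k) (A := H))).comp
    (Coalgebra.comul (R := k) (A := H))

/-- The Yetter-Drinfeld compatibility condition
`ρ(h • m) = h₂ • m₀ ⊗ h₃ m₁ S⁻¹(h₁)`, expressed via arbitrary Sweedler
decompositions of `Δ²(h)` and `ρ(m)` into finite sums of pure tensors. -/
def IsYDCompat (Sinv : H →ₗ[k] H) {M : Type} [AddCommGroup M] [Module k M] [Module H M]
    (ρ : M →ₗ[k] M ⊗[k] H) : Prop :=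
  ∀ (h : H) (m : M) (s t : Finset ℕ) (a b c : ℕ → H) (m₀ : ℕ → M) (m₁ : ℕ → H),
    (∑ i ∈ s, (a i ⊗ₜ[k] b i) ⊗ₜ[k] c i) = Delta2 k H h →
    (∑ j ∈ t, m₀ j ⊗ₜ[k] m₁ j) = ρ m →
    ρ (h • m) = ∑ i ∈ s, ∑ j ∈ t, (b i • m₀ j) ⊗ₜ[k] (c i * m₁ j * Sinv (a i))

/-- The `k`-linear map `m ↦ h • m`. -/
def smulMap {M : Type} [AddCommGroup M] [Module k M] [Module H M] [SMulCommClass H k M]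
    (h : H) : M →ₗ[k] M where
  toFun m := h • m
  map_add' := smul_add h
  map_smul' c m := (smul_comm h c m)

/-- The Long dimodule compatibility condition `ρ(h • m) = h • m₀ ⊗ m₁`. -/
def IsLongCompat {M : Type} [AddCommGroup M] [Module k M] [Module H M] [SMulCommClass H k M]
    (ρ : M →ₗ[k] M ⊗[k] H) : Prop :=
  ∀ (h : H) (m : M), ρ (h • m) = (LinearMap.rTensor H (smulMap k H h)) (ρ m)

/-- Morphisms in the categories of Yetter-Drinfeld modules and of Long dimodules:
`H`-linear and `H`-colinear maps. -/
def IsHom {A B : Type} [AddCommGroup A] [Module k A] [Module H A]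
    [AddCommGroup B] [Module k B] [Module H B]
    (ρA : A →ₗ[k] A ⊗[k] H) (ρB : B →ₗ[k] B ⊗[k] H) (f : A →ₗ[k] B) : Prop :=
  (∀ (h : H) (a : A), f (h • a) = h • f a) ∧
  ρB.comp f = (LinearMap.rTensor H f).comp ρA

/-- `H`-colinearity of a `k`-linear map between right `H`-comodules. -/
def IsColin {A B : Type} [AddCommGroup A] [Module k A]
    [AddCommGroup B] [Module k B]
    (ρA : A →ₗ[k] A ⊗[k] H) (ρB : B →ₗ[k] B ⊗[k] H) (f : A →ₗ[k] B) : Prop :=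
  ρB.comp f = (LinearMap.rTensor H f).comp ρA

/-- A bundled left-right Yetter-Drinfeld module over `H` (with chosen inverse `Sinv`
of the antipode). -/
structure YDCat (Sinv : H →ₗ[k] H) where
  M : Type
  [iAdd : AddCommGroup M]
  [iModk : Module k M]
  [iModH : Module H M]
  [iTower : IsScalarTower k H M]
  [iComm : SMulCommClass H k M]
  ρ : M →ₗ[k] M ⊗[k] H
  comod : IsComod k H ρ
  compat : IsYDCompat k H Sinv ρ

attribute [instance] YDCat.iAdd YDCat.iModk YDCat.iModH YDCat.iTower YDCat.iComm

/-- A bundled left-right Long dimodule over `H`. -/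
structure LongCat where
  M : Type
  [iAdd : AddCommGroup M]
  [iModk : Module k M]
  [iModH : Module H M]
  [iTower : IsScalarTower k H M]
  [iComm : SMulCommClass H k M]
  ρ : M →ₗ[k] M ⊗[k] H
  comod : IsComod k H ρ
  compat : IsLongCompat k H ρ

attribute [instance] LongCat.iAdd LongCat.iModk LongCat.iModH LongCat.iTower LongCat.iComm

/-- A bundled right `H`-comodule. -/
structure ComodCat where
  V : Type
  [iAdd : AddCommGroup V]
  [iModk : Module k V]
  ρ : V →ₗ[k] V ⊗[k] H
  comod : IsComod k H ρ

attribute [instance] ComodCat.iAdd ComodCat.iModk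

section Subobjects

variable {k H}
variable {M : Type} [AddCommGroup M] [Module k M] [Module H M] [IsScalarTower k H M]

/-- A subobject in the category of Yetter-Drinfeld modules (or Long dimodules):
an `H`-submodule which is stable under the coaction, i.e. `ρ(p) ⊆ p ⊗ H`. -/
def IsSubobject (ρ : M →ₗ[k] M ⊗[k] H) (p : Submodule H M) : Prop :=
  ∀ m ∈ p, ρ m ∈ LinearMap.range (LinearMap.rTensor H (p.restrictScalars k).subtype)

/-- A simple subobject: a nonzero coaction-stable `H`-submodule with no proper
nonzero coaction-stable `H`-submodules. -/
def IsSimpleSubobject (ρ : M →ₗ[k] M ⊗[k] H) (p : Submodule H M) : Prop :=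
  IsSubobject ρ p ∧ p ≠ ⊥ ∧
    ∀ q : Submodule H M, IsSubobject ρ q → q ≤ p → q = ⊥ ∨ q = p

/-- `M` is the (internal) direct sum of a family of simple subobjects which are
finitely generated as `H`-modules. -/
def IsSemisimpleObj (ρ : M →ₗ[k] M ⊗[k] H) : Prop :=
  ∃ (ι : Type) (S : ι → Submodule H M),
    (∀ i, IsSimpleSubobject ρ (S i) ∧ (S i).FG) ∧
    iSupIndep S ∧ (⨆ i, S i) = ⊤

end Subobjects

section Subcomodules

variable {k H}
variable {V : Type} [AddCommGroup V] [Module k V]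

/-- A subcomodule: a `k`-submodule stable under the coaction. -/
def IsSubcomod (ρ : V →ₗ[k] V ⊗[k] H) (p : Submodule k V) : Prop :=
  ∀ v ∈ p, ρ v ∈ LinearMap.range (LinearMap.rTensor H p.subtype)

/-- A simple subcomodule. -/
def IsSimpleSubcomod (ρ : V →ₗ[k] V ⊗[k] H) (p : Submodule k V) : Prop :=
  IsSubcomod ρ p ∧ p ≠ ⊥ ∧
    ∀ q : Submodule k V, IsSubcomod ρ q → q ≤ p → q = ⊥ ∨ q = p

/-- A comodule is semisimple if it is the internal direct sum of a family of simple
subcomodules. -/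
def IsSemisimpleComod (ρ : V →ₗ[k] V ⊗[k] H) : Prop :=
  ∃ (ι : Type) (S : ι → Submodule k V),
    (∀ i, IsSimpleSubcomod ρ (S i)) ∧ iSupIndep S ∧ (⨆ i, S i) = ⊤

end Subcomodules

/-- `H` is cosemisimple: every right `H`-comodule is a direct sum of simple
subcomodules. -/
def Cosemisimple : Prop := ∀ C : ComodCat k H, IsSemisimpleComod C.ρ

section Coinv

variable {k H}
variable {A B : Type} [AddCommGroup A] [Module k A] [AddCommGroup B] [Module k B]

/-- The coinvariants `M^{co H} = { m | ρ m = m ⊗ 1 }` of a right `H`-comodule. -/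
def coinv (ρ : A →ₗ[k] A ⊗[k] H) : Submodule k A :=
  LinearMap.ker (ρ - (TensorProduct.mk k A H).flip 1)

lemma mem_coinv {ρ : A →ₗ[k] A ⊗[k] H} {a : A} :
    a ∈ coinv ρ ↔ ρ a = a ⊗ₜ[k] (1 : H) := by
  simp [coinv, LinearMap.mem_ker, sub_eq_zero]

/-- The map induced on coinvariants by an `H`-colinear map. -/
def coinvMap {ρA : A →ₗ[k] A ⊗[k] H} {ρB : B →ₗ[k] B ⊗[k] H} (f : A →ₗ[k] B)
    (hf : IsColin k H ρA ρB f) : ↥(coinv ρA) →ₗ[k] ↥(coinv ρB) :=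
  f.restrict (fun a ha => by
    have h1 : ρA a = a ⊗ₜ[k] (1 : H) := mem_coinv.1 ha
    have h2 : ρB (f a) = (LinearMap.rTensor H f) (ρA a) := by
      have := congrArg (fun (g : A →ₗ[k] B ⊗[k] H) => g a) hf
      simpa using this
    rw [mem_coinv, h2, h1, LinearMap.rTensor_tmul])

end Coinv

/-- Exactness of the coinvariants functor on the category of Yetter-Drinfeld
modules. -/
def CoinvExactYD (Sinv : H →ₗ[k] H) : Prop :=
  ∀ (A B C : YDCat k H Sinv) (f : A.M →ₗ[k] B.M) (g : B.M →ₗ[k] C.M)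
    (hf : IsHom k H A.ρ B.ρ f) (hg : IsHom k H B.ρ C.ρ g),
    Function.Injective f → Function.Surjective g →
    LinearMap.range f = LinearMap.ker g →
    Function.Injective (coinvMap f hf.2) ∧
    LinearMap.range (coinvMap f hf.2) = LinearMap.ker (coinvMap g hg.2) ∧
    Function.Surjective (coinvMap g hg.2)

/-- Exactness of the coinvariants functor on the category of right `H`-comodules. -/
def CoinvExactComod : Prop :=
  ∀ (A B C : ComodCat k H) (f : A.V →ₗ[k] B.V) (g : B.V →ₗ[k] C.V)
    (hf : IsColin k H A.ρ B.ρ f) (hg : IsColin k H B.ρ C.ρ g),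
    Function.Injective f → Function.Surjective g →
    LinearMap.range f = LinearMap.ker g →
    Function.Injective (coinvMap f hf) ∧
    LinearMap.range (coinvMap f hf) = LinearMap.ker (coinvMap g hg) ∧
    Function.Surjective (coinvMap g hg)

section Eval

variable {k H}
variable {M N : Type} [AddCommGroup M] [Module k M] [Module H M]
  [IsScalarTower k H M] [SMulCommClass H k M]
  [AddCommGroup N] [Module k N] [Module H N] [IsScalarTower k H N] [SMulCommClass H k N]

/-- Evaluation at `m` of `H`-linear maps, as a `k`-linear map. -/
def evalAtH (m : M) : (M →ₗ[H] N) →ₗ[k] N where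
  toFun f := f m
  map_add' _ _ := rfl
  map_smul' _ _ := rfl

/-- Evaluation at `m` of `k`-linear maps, as a `k`-linear map. -/
def evalAtK {V : Type} [AddCommGroup V] [Module k V] (v : V) :
    (V →ₗ[k] N) →ₗ[k] N where
  toFun f := f v
  map_add' _ _ := rfl
  map_smul' _ _ := rfl

/-- Contraction `N ⊗ H → N` along a functional `φ : H → k`. -/
def contract (φ : H →ₗ[k] k) : N ⊗[k] H →ₗ[k] N :=
  (TensorProduct.rid k N).toLinearMap.comp (LinearMap.lTensor N φ)

/-- Post-composition with an `H`-linear map, as a `k`-linear map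
`Hom_H(X, M) → Hom_H(X, N)`; here `X` is the (implicit) source. -/
def postcompH {X : Type} [AddCommGroup X] [Module k X] [Module H X]
    [IsScalarTower k H X] [SMulCommClass H k X]
    (f : M →ₗ[k] N) (hf : ∀ (h : H) (m : M), f (h • m) = h • f m) :
    (X →ₗ[H] M) →ₗ[k] (X →ₗ[H] N) where
  toFun φ :=
    { toFun := fun x => f (φ x)
      map_add' := fun x y => by simp
      map_smul' := fun h x => by simp [hf] }
  map_add' φ ψ := by ext x; simp
  map_smul' c φ := by ext x; simp

end Eval

/-- Condition (†) for the category of Yetter-Drinfeld modules: for every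
Yetter-Drinfeld module `X` which is finitely generated as a left `H`-module,
the functor `Hom_H(X, -)` is exact on the category of Yetter-Drinfeld modules. -/
def DaggerYD (Sinv : H →ₗ[k] H) : Prop :=
  ∀ X : YDCat k H Sinv, Module.Finite H X.M →
  ∀ (A B C : YDCat k H Sinv) (f : A.M →ₗ[k] B.M) (g : B.M →ₗ[k] C.M)
    (hf : IsHom k H A.ρ B.ρ f) (hg : IsHom k H B.ρ C.ρ g),
    Function.Injective f → Function.Surjective g →
    LinearMap.range f = LinearMap.ker g →
    Function.Injective (postcompH (X := X.M) f hf.1) ∧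
    LinearMap.range (postcompH (X := X.M) f hf.1) =
      LinearMap.ker (postcompH (X := X.M) g hg.1) ∧
    Function.Surjective (postcompH (X := X.M) g hg.1)

/-- Condition (†) for the category of Long dimodules. -/
def DaggerLong : Prop :=
  ∀ X : LongCat k H, Module.Finite H X.M →
  ∀ (A B C : LongCat k H) (f : A.M →ₗ[k] B.M) (g : B.M →ₗ[k] C.M)
    (hf : IsHom k H A.ρ B.ρ f) (hg : IsHom k H B.ρ C.ρ g),
    Function.Injective f → Function.Surjective g →
    LinearMap.range f = LinearMap.ker g →
    Function.Injective (postcompH (X := X.M) f hf.1) ∧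
    LinearMap.range (postcompH (X := X.M) f hf.1) =
      LinearMap.ker (postcompH (X := X.M) g hg.1) ∧
    Function.Surjective (postcompH (X := X.M) g hg.1)

/-- Projective object in the category of Yetter-Drinfeld modules. -/
def IsProjectiveYD (Sinv : H →ₗ[k] H) (P : YDCat k H Sinv) : Prop :=
  ∀ (A B : YDCat k H Sinv) (g : A.M →ₗ[k] B.M) (f : P.M →ₗ[k] B.M),
    IsHom k H A.ρ B.ρ g → Function.Surjective g → IsHom k H P.ρ B.ρ f →
    ∃ l : P.M →ₗ[k] A.M, IsHom k H P.ρ A.ρ l ∧ g.comp l = f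

/-- Projective object in the category of Long dimodules. -/
def IsProjectiveLong (P : LongCat k H) : Prop :=
  ∀ (A B : LongCat k H) (g : A.M →ₗ[k] B.M) (f : P.M →ₗ[k] B.M),
    IsHom k H A.ρ B.ρ g → Function.Surjective g → IsHom k H P.ρ B.ρ f →
    ∃ l : P.M →ₗ[k] A.M, IsHom k H P.ρ A.ρ l ∧ g.comp l = f

/-- Injective object in the category of Yetter-Drinfeld modules. -/
def IsInjectiveYD (Sinv : H →ₗ[k] H) (I : YDCat k H Sinv) : Prop :=
  ∀ (A B : YDCat k H Sinv) (ι : A.M →ₗ[k] B.M) (f : A.M →ₗ[k] I.M),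
    IsHom k H A.ρ B.ρ ι → Function.Injective ι → IsHom k H A.ρ I.ρ f →
    ∃ g : B.M →ₗ[k] I.M, IsHom k H B.ρ I.ρ g ∧ g.comp ι = f

/-- Projective object in the category of right `H`-comodules. -/
def IsProjectiveComod (P : ComodCat k H) : Prop :=
  ∀ (A B : ComodCat k H) (g : A.V →ₗ[k] B.V) (f : P.V →ₗ[k] B.V),
    IsColin k H A.ρ B.ρ g → Function.Surjective g → IsColin k H P.ρ B.ρ f →
    ∃ l : P.V →ₗ[k] A.V, IsColin k H P.ρ A.ρ l ∧ g.comp l = f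

section HomLemmas

variable {k H}
variable {A B C : Type} [AddCommGroup A] [Module k A] [Module H A]
  [AddCommGroup B] [Module k B] [Module H B]
  [AddCommGroup C] [Module k C] [Module H C]

lemma IsHom.comp' {ρA : A →ₗ[k] A ⊗[k] H} {ρB : B →ₗ[k] B ⊗[k] H} {ρC : C →ₗ[k] C ⊗[k] H}
    {f : A →ₗ[k] B} {g : B →ₗ[k] C}
    (hf : IsHom k H ρA ρB f) (hg : IsHom k H ρB ρC g) :
    IsHom k H ρA ρC (g.comp f) := by
  refine ⟨fun h a => by simp [LinearMap.comp_apply, hf.1, hg.1], ?_⟩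
  calc ρC.comp (g.comp f) = (ρC.comp g).comp f := by rw [LinearMap.comp_assoc]
    _ = ((LinearMap.rTensor H g).comp ρB).comp f := by rw [hg.2]
    _ = (LinearMap.rTensor H g).comp (ρB.comp f) := by rw [LinearMap.comp_assoc]
    _ = (LinearMap.rTensor H g).comp ((LinearMap.rTensor H f).comp ρA) := by rw [hf.2]
    _ = ((LinearMap.rTensor H g).comp (LinearMap.rTensor H f)).comp ρA := by
          rw [LinearMap.comp_assoc]
    _ = (LinearMap.rTensor H (g.comp f)).comp ρA := by rw [LinearMap.rTensor_comp]

end HomLemmas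

section HomYD

variable {k H}
variable (Sinv : H →ₗ[k] H)

/-- The `k`-module of morphisms of Yetter-Drinfeld modules `Hom_H^H(A, B)`, as a
submodule of the `k`-linear maps. -/
def homYD (A B : YDCat k H Sinv) : Submodule k (A.M →ₗ[k] B.M) where
  carrier := {f | IsHom k H A.ρ B.ρ f}
  add_mem' := by
    rintro f g ⟨hf1, hf2⟩ ⟨hg1, hg2⟩
    refine ⟨fun h a => by simp [hf1, hg1, smul_add], ?_⟩
    rw [LinearMap.comp_add, LinearMap.rTensor_add, LinearMap.add_comp, hf2, hg2]
  zero_mem' := by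
    refine ⟨fun h a => by simp, ?_⟩
    rw [LinearMap.comp_zero, LinearMap.rTensor_zero, LinearMap.zero_comp]
  smul_mem' := by
    rintro c f ⟨hf1, hf2⟩
    refine ⟨fun h a => by
      rw [LinearMap.smul_apply, LinearMap.smul_apply, hf1, smul_comm], ?_⟩
    rw [LinearMap.comp_smul, LinearMap.rTensor_smul, LinearMap.smul_comp, hf2]

/-- Post-composition with a morphism of Yetter-Drinfeld modules, as a `k`-linear map
between morphism spaces. -/
def postcompYD {X B C : YDCat k H Sinv}
    (g : B.M →ₗ[k] C.M) (hg : IsHom k H B.ρ C.ρ g) :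
    ↥(homYD Sinv X B) →ₗ[k] ↥(homYD Sinv X C) where
  toFun f := ⟨g.comp f.1, IsHom.comp' f.2 hg⟩
  map_add' f g' := by ext x; simp
  map_smul' c f := by ext x; simp

/-- An injective resolution `0 → X → I⁰ → I¹ → ⋯` in the category of
Yetter-Drinfeld modules. -/
structure IsInjRes (X : YDCat k H Sinv) (I : ℕ → YDCat k H Sinv)
    (ε : X.M →ₗ[k] (I 0).M) (d : ∀ n, (I n).M →ₗ[k] (I (n + 1)).M) : Prop where
  eps_hom : IsHom k H X.ρ (I 0).ρ ε
  d_hom : ∀ n, IsHom k H (I n).ρ (I (n + 1)).ρ (d n)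
  inj : ∀ n, IsInjectiveYD k H Sinv (I n)
  mono : Function.Injective ε
  exact0 : LinearMap.range ε = LinearMap.ker (d 0)
  exact : ∀ n, LinearMap.range (d n) = LinearMap.ker (d (n + 1))

/-- A projective resolution `⋯ → P₁ → P₀ → X → 0` in the category of
Yetter-Drinfeld modules. -/
structure IsProjRes (X : YDCat k H Sinv) (P : ℕ → YDCat k H Sinv)
    (ε : (P 0).M →ₗ[k] X.M) (d : ∀ n, (P (n + 1)).M →ₗ[k] (P n).M) : Prop where
  eps_hom : IsHom k H (P 0).ρ X.ρ ε
  d_hom : ∀ n, IsHom k H (P (n + 1)).ρ (P n).ρ (d n)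
  proj : ∀ n, IsProjectiveYD k H Sinv (P n)
  epi : Function.Surjective ε
  exact0 : LinearMap.range (d 0) = LinearMap.ker ε
  exact : ∀ n, LinearMap.range (d (n + 1)) = LinearMap.ker (d n)

/-- The projective dimension of `X` in the category of Yetter-Drinfeld modules is
at most `n`. -/
def pdimLE (X : YDCat k H Sinv) (n : ℕ) : Prop :=
  ∃ (P : ℕ → YDCat k H Sinv) (ε : (P 0).M →ₗ[k] X.M)
    (d : ∀ m, (P (m + 1)).M →ₗ[k] (P m).M),
    IsProjRes Sinv X P ε d ∧ ∀ i, n < i → Subsingleton (P i).M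

/-- The injective dimension of `X` in the category of Yetter-Drinfeld modules is
at most `n`. -/
def injdimLE (X : YDCat k H Sinv) (n : ℕ) : Prop :=
  ∃ (I : ℕ → YDCat k H Sinv) (ε : X.M →ₗ[k] (I 0).M)
    (d : ∀ m, (I m).M →ₗ[k] (I (m + 1)).M),
    IsInjRes Sinv X I ε d ∧ ∀ i, n < i → Subsingleton (I i).M

/-- The complex `Hom(X, I⁰) → Hom(X, I¹) → ⋯` of morphism spaces induced by a
cochain of Yetter-Drinfeld modules. -/
def homCx (X : YDCat k H Sinv) (I : ℕ → YDCat k H Sinv)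
    (d : ∀ n, (I n).M →ₗ[k] (I (n + 1)).M)
    (hd : ∀ n, IsHom k H (I n).ρ (I (n + 1)).ρ (d n)) (n : ℕ) :
    ↥(homYD Sinv X (I n)) →ₗ[k] ↥(homYD Sinv X (I (n + 1))) :=
  postcompYD Sinv (d n) (hd n)

/-- Coboundaries of the induced complex. -/
def boundaries (X : YDCat k H Sinv) (I : ℕ → YDCat k H Sinv)
    (d : ∀ n, (I n).M →ₗ[k] (I (n + 1)).M)
    (hd : ∀ n, IsHom k H (I n).ρ (I (n + 1)).ρ (d n)) :
    ∀ i, Submodule k ↥(homYD Sinv X (I i))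
  | 0 => ⊥
  | (i + 1) => LinearMap.range (homCx Sinv X I d hd i)

/-- The `i`-th cohomology (cocycles modulo coboundaries) of the complex
`Hom(X, I⁰) → Hom(X, I¹) → ⋯`; when `I` is an injective resolution of `Y`, this is
`Ext^i(X, Y)`, the `i`-th right derived functor of `Hom_H^H(X, -)`, in the category
of Yetter-Drinfeld modules. -/
abbrev cohomology (X : YDCat k H Sinv) (I : ℕ → YDCat k H Sinv)
    (d : ∀ n, (I n).M →ₗ[k] (I (n + 1)).M)
    (hd : ∀ n, IsHom k H (I n).ρ (I (n + 1)).ρ (d n)) (i : ℕ) : Type :=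
  ↥(Submodule.map (boundaries Sinv X I d hd i).mkQ
      (LinearMap.ker (homCx Sinv X I d hd i)))

end HomYD

section CharProps

variable {k H}
variable (Sinv : H →ₗ[k] H)

/-- Characterizing property of the coaction on `Hom_H(A, B)` for Yetter-Drinfeld
modules `A`, `B`: it is determined by `f₀(m) ⊗ f₁ = f(m₀)₀ ⊗ f(m₀)₁ S(m₁)`. -/
def HomCoactChar (A B : YDCat k H Sinv)
    (ρQ : (A.M →ₗ[H] B.M) →ₗ[k] (A.M →ₗ[H] B.M) ⊗[k] H) : Prop :=
  ∀ (f : A.M →ₗ[H] B.M) (m : A.M) (t : Finset ℕ) (m₀ : ℕ → A.M) (m₁ : ℕ → H),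
    (∑ j ∈ t, m₀ j ⊗ₜ[k] m₁ j) = A.ρ m →
    (LinearMap.rTensor H (evalAtH (N := B.M) m)) (ρQ f) =
      ∑ j ∈ t, (LinearMap.lTensor B.M
          (LinearMap.mulRight k (HopfAlgebra.antipode (R := k) (A := H) (m₁ j))))
        (B.ρ (f (m₀ j)))

/-- Characterizing property of the coaction on `Hom_k(V, B)` for a comodule `V` and
a Yetter-Drinfeld module `B`: `g₀(v) ⊗ g₁ = g(v₀)₀ ⊗ g(v₀)₁ S(v₁)`. -/
def HomKCoactChar (V : ComodCat k H) (B : YDCat k H Sinv)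
    (ρ' : (V.V →ₗ[k] B.M) →ₗ[k] (V.V →ₗ[k] B.M) ⊗[k] H) : Prop :=
  ∀ (g : V.V →ₗ[k] B.M) (v : V.V) (t : Finset ℕ) (v₀ : ℕ → V.V) (v₁ : ℕ → H),
    (∑ j ∈ t, v₀ j ⊗ₜ[k] v₁ j) = V.ρ v →
    (LinearMap.rTensor H (evalAtK (N := B.M) v)) (ρ' g) =
      ∑ j ∈ t, (LinearMap.lTensor B.M
          (LinearMap.mulRight k (HopfAlgebra.antipode (R := k) (A := H) (v₁ j))))
        (B.ρ (g (v₀ j)))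

/-- Characterizing property of the Yetter-Drinfeld coaction on `H ⊗ V`:
`ρ(h ⊗ v) = h₂ ⊗ v₀ ⊗ h₃ v₁ S⁻¹(h₁)`. -/
def HTensorYDChar (V : ComodCat k H)
    (ρT : (H ⊗[k] V.V) →ₗ[k] (H ⊗[k] V.V) ⊗[k] H) : Prop :=
  ∀ (h : H) (v : V.V) (s t : Finset ℕ) (a b c : ℕ → H) (v₀ : ℕ → V.V) (v₁ : ℕ → H),
    (∑ i ∈ s, (a i ⊗ₜ[k] b i) ⊗ₜ[k] c i) = Delta2 k H h →
    (∑ j ∈ t, v₀ j ⊗ₜ[k] v₁ j) = V.ρ v →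
    ρT (h ⊗ₜ[k] v) =
      ∑ i ∈ s, ∑ j ∈ t, (b i ⊗ₜ[k] v₀ j) ⊗ₜ[k] (c i * v₁ j * Sinv (a i))

/-- Characterizing property of the Long dimodule coaction on `H ⊗ V`:
`ρ(h ⊗ v) = h ⊗ v₀ ⊗ v₁`. -/
def HTensorLongChar (V : ComodCat k H)
    (ρT : (H ⊗[k] V.V) →ₗ[k] (H ⊗[k] V.V) ⊗[k] H) : Prop :=
  ∀ (h : H) (v : V.V) (t : Finset ℕ) (v₀ : ℕ → V.V) (v₁ : ℕ → H),
    (∑ j ∈ t, v₀ j ⊗ₜ[k] v₁ j) = V.ρ v →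
    ρT (h ⊗ₜ[k] v) = ∑ j ∈ t, (h ⊗ₜ[k] v₀ j) ⊗ₜ[k] v₁ j

end CharProps

end RingPart

section CommPart

variable {k H : Type} [CommRing k] [CommRing H] [HopfAlgebra k H] (Sinv : H →ₗ[k] H)

/-- Characterizing property of the Yetter-Drinfeld coaction on `M ⊗_H N`:
`ρ(m ⊗ n) = m₀ ⊗ n₀ ⊗ n₁ m₁` (for `H` commutative). -/
def TensorCoactChar (A B : YDCat k H Sinv)
    (ρT : (A.M ⊗[H] B.M) →ₗ[k] (A.M ⊗[H] B.M) ⊗[k] H) : Prop :=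
  ∀ (m : A.M) (n : B.M) (s t : Finset ℕ) (m₀ : ℕ → A.M) (m₁ : ℕ → H)
    (n₀ : ℕ → B.M) (n₁ : ℕ → H),
    (∑ i ∈ s, m₀ i ⊗ₜ[k] m₁ i) = A.ρ m →
    (∑ j ∈ t, n₀ j ⊗ₜ[k] n₁ j) = B.ρ n →
    ρT (m ⊗ₜ[H] n) =
      ∑ i ∈ s, ∑ j ∈ t, (m₀ i ⊗ₜ[H] n₀ j) ⊗ₜ[k] (n₁ j * m₁ i)

/-- Restriction along `v ↦ 1 ⊗ v`, i.e. the canonical map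
`Hom_H(H ⊗ V, N) → Hom_k(V, N)`, `f ↦ (v ↦ f(1 ⊗ v))`. -/
def resUnitMap (V : Type) [AddCommGroup V] [Module k V] (N : Type) [AddCommGroup N]
    [Module k N] [Module H N] [IsScalarTower k H N] [SMulCommClass H k N] :
    ((H ⊗[k] V) →ₗ[H] N) →ₗ[k] (V →ₗ[k] N) where
  toFun f := (f.restrictScalars k).comp ((TensorProduct.mk k H V) 1)
  map_add' f g := by ext v; rfl
  map_smul' c f := by ext v; rfl

end CommPart

section Aux
open LinearMap

variable {k H : Type} [Field k] [CommRing H] [HopfAlgebra k H]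

section act
variable (M : Type) [AddCommGroup M] [Module k M] [Module H M] [IsScalarTower k H M]
  [SMulCommClass H k M]

/-- The action of `H ⊗ H` on `M ⊗ H`. -/
def act : (H ⊗[k] H) →ₐ[k] Module.End k (M ⊗[k] H) :=
  (Module.endTensorEndAlgHom (R := k) (S := k) (A := k) (M := M) (N := H)).comp
    (Algebra.TensorProduct.map (Algebra.lsmul k k M) (Algebra.lmul k H))

variable {M}
@[simp] lemma act_tmul (h x : H) (m : M) (y : H) :
    act M (h ⊗ₜ[k] x) (m ⊗ₜ[k] y) = (h • m) ⊗ₜ[k] (x * y) := by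
  simp only [act, AlgHom.comp_apply, Algebra.TensorProduct.map_tmul]
  rw [Module.endTensorEndAlgHom_apply]
  simp

lemma act_rTensor {N : Type} [AddCommGroup N] [Module k N] [Module H N] [IsScalarTower k H N]
    [SMulCommClass H k N] (f : M →ₗ[k] N) (hf : ∀ (h : H) (m : M), f (h • m) = h • f m)
    (w : H ⊗[k] H) (u : M ⊗[k] H) :
    rTensor H f (act M w u) = act N w (rTensor H f u) := by
  induction w with
  | zero => simp
  | add a b ha hb => simp [ha, hb]
  | tmul h x =>
    induction u with
    | zero => simp
    | add a b ha hb => simp [ha, hb]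
    | tmul m y => simp [hf]
end act

/-- `ρ̂(a ⊗ y) = ρ(a) y`. -/
def rhat {M : Type} [AddCommGroup M] [Module k M] (ρ : M →ₗ[k] M ⊗[k] H) :
    M ⊗[k] H →ₗ[k] M ⊗[k] H :=
  lTensor M (LinearMap.mul' k H) ∘ₗ (TensorProduct.assoc k M H H).toLinearMap ∘ₗ rTensor H ρ

section comod
variable {M : Type} [AddCommGroup M] [Module k M] (ρ : M →ₗ[k] M ⊗[k] H)

lemma rhat_tmul (m : M) (y : H) :
    rhat ρ (m ⊗ₜ y) = lTensor M (LinearMap.mulRight k y) (ρ m) := by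
  simp only [rhat, coe_comp, Function.comp_apply, rTensor_tmul, LinearEquiv.coe_coe]
  induction ρ m with
  | zero => simp
  | add a b ha hb => simp [ha, hb, TensorProduct.add_tmul]
  | tmul a x => simp

lemma rhat_one (m : M) : rhat ρ (m ⊗ₜ 1) = ρ m := by
  rw [rhat_tmul, LinearMap.mulRight_one, lTensor_id, id_apply]

lemma rhat_mulRight (u : M ⊗[k] H) (y : H) :
    rhat ρ (lTensor M (LinearMap.mulRight k y) u) =
      lTensor M (LinearMap.mulRight k y) (rhat ρ u) := by
  induction u with
  | zero => simp
  | add a b ha hb => simp [ha, hb]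
  | tmul a x =>
    simp only [lTensor_tmul, mulRight_apply, rhat_tmul, LinearMap.mulRight_mul, lTensor_comp,
      coe_comp, Function.comp_apply]

/-- `σ(a) = a₀ ⊗ S(a₁)`. -/
def sig : M →ₗ[k] M ⊗[k] H := lTensor M (HopfAlgebra.antipode k (A := H)) ∘ₗ ρ

lemma lT_assoc_l (T : H →ₗ[k] H) (z : (M ⊗[k] H) ⊗[k] H) :
    TensorProduct.assoc k M H H (lTensor (M ⊗[k] H) T z) =
      lTensor M (lTensor H T) (TensorProduct.assoc k M H H z) := by
  have : (TensorProduct.assoc k M H H).toLinearMap ∘ₗ (lTensor (M ⊗[k] H) T) =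
    lTensor M (lTensor H T) ∘ₗ (TensorProduct.assoc k M H H).toLinearMap := by
    ext; simp
  exact congr($this z)

lemma lT_assoc_r (T : H →ₗ[k] H) (z : (M ⊗[k] H) ⊗[k] H) :
    TensorProduct.assoc k M H H (rTensor H (lTensor M T) z) =
      lTensor M (rTensor H T) (TensorProduct.assoc k M H H z) := by
  have : (TensorProduct.assoc k M H H).toLinearMap ∘ₗ (rTensor H (lTensor M T)) =
    lTensor M (rTensor H T) ∘ₗ (TensorProduct.assoc k M H H).toLinearMap := by
    ext; simp
  exact congr($this z)

variable {ρ}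

lemma lT_eps (hρ : IsComod k H ρ) (m : M) :
    lTensor M (Algebra.linearMap k H ∘ₗ Coalgebra.counit (R := k) (A := H)) (ρ m) = m ⊗ₜ 1 := by
  have h := hρ.1 m
  rw [lTensor_comp, comp_apply]
  have h2 : ∀ z : M ⊗[k] k, lTensor M (Algebra.linearMap k H) z = (TensorProduct.rid k M z) ⊗ₜ 1 := by
    intro z
    induction z with
    | zero => simp
    | add a b ha hb => simp [ha, hb, TensorProduct.add_tmul]
    | tmul a x => simp [Algebra.algebraMap_eq_smul_one, TensorProduct.smul_tmul]
  rw [h2, h]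

lemma rhat_sig (hρ : IsComod k H ρ) (m : M) : rhat ρ (sig ρ m) = m ⊗ₜ 1 := by
  have h := hρ.2 m
  rw [← lT_eps hρ m]
  have : rTensor H ρ (lTensor M (HopfAlgebra.antipode k (A := H)) (ρ m)) =
    lTensor (M ⊗[k] H) (HopfAlgebra.antipode k (A := H)) (rTensor H ρ (ρ m)) := by
    rw [← comp_apply (rTensor H ρ), rTensor_comp_lTensor, ← comp_apply (lTensor _ _),
      lTensor_comp_rTensor]
  simp only [rhat, sig, coe_comp, Function.comp_apply, LinearEquiv.coe_coe, this, lT_assoc_l, h]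
  rw [← HopfAlgebra.mul_antipode_lTensor_comul (R := k) (A := H)]
  simp only [lTensor_comp, comp_apply]

lemma sighat_rho (hρ : IsComod k H ρ) (m : M) : rhat (sig ρ) (ρ m) = m ⊗ₜ 1 := by
  have h := hρ.2 m
  rw [← lT_eps hρ m]
  simp only [rhat, sig, coe_comp, Function.comp_apply, LinearEquiv.coe_coe, rTensor_comp,
    lT_assoc_r, h]
  rw [← HopfAlgebra.mul_antipode_rTensor_comul (R := k) (A := H)]
  simp only [lTensor_comp, comp_apply]

lemma sighat_rhat (hρ : IsComod k H ρ) (u : M ⊗[k] H) : rhat (sig ρ) (rhat ρ u) = u := by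
  induction u with
  | zero => simp
  | add a b ha hb => simp [ha, hb]
  | tmul a x => rw [rhat_tmul, rhat_mulRight, sighat_rho hρ]; simp

lemma rhat_surj (hρ : IsComod k H ρ) (u : M ⊗[k] H) : ∃ v, rhat ρ v = u := by
  refine ⟨rhat (sig ρ) u, ?_⟩
  induction u with
  | zero => simp
  | add a b ha hb => simp [ha, hb]
  | tmul a x => rw [rhat_tmul, rhat_mulRight, rhat_sig hρ]; simp

end comod

lemma comul_isComod : IsComod k H (Coalgebra.comul (R := k) (A := H)) :=
  ⟨fun m => by simp, fun m => by simp⟩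

section theta
variable (Sinv : H →ₗ[k] H)

/-- `(a ⊗ b) ⊗ c ↦ b ⊗ c S⁻¹(a)`. -/
def thetaAux : (H ⊗[k] H) ⊗[k] H →ₗ[k] H ⊗[k] H :=
  TensorProduct.lift (TensorProduct.lift
    (LinearMap.mk₂ k (fun a b => (TensorProduct.mk k H H b) ∘ₗ LinearMap.mulRight k (Sinv a))
      (by intros; ext; simp [mul_add, TensorProduct.tmul_add])
      (by intros; ext; simp)
      (by intros; ext; simp)
      (by intros; ext; simp)))

@[simp] lemma thetaAux_tmul (a b c : H) :
    thetaAux (k := k) Sinv ((a ⊗ₜ b) ⊗ₜ c) = b ⊗ₜ (c * Sinv a) := by simp [thetaAux]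

/-- `θ(h) = h₂ ⊗ h₃ S⁻¹(h₁)`. -/
def theta : H →ₗ[k] H ⊗[k] H := thetaAux Sinv ∘ₗ Delta2 k H

/-- `β(h) = h₂ ⊗ S⁻¹(h₁)`. -/
def beta : H →ₗ[k] H ⊗[k] H :=
  lTensor H Sinv ∘ₗ (TensorProduct.comm k H H).toLinearMap ∘ₗ Coalgebra.comul (R := k) (A := H)

lemma theta_eq (h : H) : theta Sinv h = rhat (Coalgebra.comul (R := k) (A := H)) (beta Sinv h) := by
  have key : ∀ z : H ⊗[k] H, thetaAux Sinv ((TensorProduct.assoc k H H H).symm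
      (lTensor H (Coalgebra.comul (R := k) (A := H)) z)) =
      rhat (Coalgebra.comul (R := k) (A := H)) (lTensor H Sinv (TensorProduct.comm k H H z)) := by
    intro z
    induction z with
    | zero => simp
    | add a b ha hb => simp only [map_add, ha, hb]
    | tmul a x =>
      simp only [lTensor_tmul, TensorProduct.comm_tmul, rhat_tmul]
      induction Coalgebra.comul (R := k) x with
      | zero => simp
      | add a b ha hb => simp only [map_add, ha, hb, TensorProduct.tmul_add]
      | tmul a x => simp
  simp only [theta, beta, Delta2, coe_comp, Function.comp_apply, LinearEquiv.coe_coe, ← key]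
  simp

lemma sinv_mul (hS1 : ∀ h : H, Sinv (HopfAlgebra.antipode (R := k) (A := H) h) = h)
    (hS2 : ∀ h : H, HopfAlgebra.antipode (R := k) (A := H) (Sinv h) = h) (h : H) :
    (LinearMap.mul' k H ∘ₗ lTensor H Sinv) (Coalgebra.comul (R := k) h)
      = algebraMap k H (Coalgebra.counit (R := k) h) := by
  have inj : Function.Injective (HopfAlgebra.antipode k (A := H)) :=
    Function.LeftInverse.injective hS1
  apply inj
  have e : ∀ z : H ⊗[k] H, HopfAlgebra.antipode k (A := H)
      ((LinearMap.mul' k H ∘ₗ lTensor H Sinv) z) =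
      LinearMap.mul' k H (rTensor H (HopfAlgebra.antipode k (A := H)) z) := by
    intro z
    induction z with
    | zero => simp
    | add a b ha hb => simp only [map_add, ha, hb]
    | tmul a x => simp [HopfAlgebra.antipode_mul_antidistrib, hS2, mul_comm]
  rw [e, HopfAlgebra.mul_antipode_rTensor_comul_apply]
  simp [Algebra.algebraMap_eq_smul_one]

lemma beta_surj (hS1 : ∀ h : H, Sinv (HopfAlgebra.antipode (R := k) (A := H) h) = h)
    (hS2 : ∀ h : H, HopfAlgebra.antipode (R := k) (A := H) (Sinv h) = h) (u : H ⊗[k] H) :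
    ∃ v, rhat (beta Sinv) v = u := by
  have key : ∀ h : H, rhat (beta (k := k) Sinv)
      (TensorProduct.comm k H H (Coalgebra.comul (R := k) h)) = h ⊗ₜ 1 := by
    intro h
    have k2 : ∀ z : H ⊗[k] H, rhat (beta (k := k) Sinv) (TensorProduct.comm k H H z) =
        TensorProduct.comm k H H (rTensor H (LinearMap.mul' k H ∘ₗ lTensor H Sinv)
        ((TensorProduct.assoc k H H H).symm
          (lTensor H (Coalgebra.comul (R := k) (A := H)) z))) := by
      intro z
      induction z with
      | zero => simp
      | add a b ha hb => simp only [map_add, ha, hb]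
      | tmul a x =>
        simp only [lTensor_tmul, TensorProduct.comm_tmul, rhat_tmul, beta, coe_comp,
          Function.comp_apply, LinearEquiv.coe_coe]
        induction Coalgebra.comul (R := k) x with
        | zero => simp
        | add a b ha hb => simp only [map_add, ha, hb, TensorProduct.tmul_add]
        | tmul a x => simp [mul_comm]
    rw [k2, Coalgebra.coassoc_symm_apply, ← comp_apply, ← rTensor_comp]
    have : (LinearMap.mul' k H ∘ₗ lTensor H Sinv) ∘ₗ Coalgebra.comul (R := k) (A := H) =
      Algebra.linearMap k H ∘ₗ Coalgebra.counit := by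
      ext h; exact sinv_mul Sinv hS1 hS2 h
    rw [this, rTensor_comp, comp_apply, Coalgebra.rTensor_counit_comul]
    simp
  induction u with
  | zero => exact ⟨0, by simp⟩
  | add a b ha hb =>
    obtain ⟨a, rfl⟩ := ha
    obtain ⟨b, rfl⟩ := hb
    exact ⟨a + b, by simp⟩
  | tmul h y =>
    refine ⟨lTensor H (mulRight k y) (TensorProduct.comm k H H (Coalgebra.comul (R := k) h)), ?_⟩
    rw [rhat_mulRight, key]; simp

lemma theta_surj (hS1 : ∀ h : H, Sinv (HopfAlgebra.antipode (R := k) (A := H) h) = h)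
    (hS2 : ∀ h : H, HopfAlgebra.antipode (R := k) (A := H) (Sinv h) = h) (u : H ⊗[k] H) :
    ∃ v, rhat (theta Sinv) v = u := by
  obtain ⟨v, rfl⟩ := rhat_surj (comul_isComod (k := k) (H := H)) u
  obtain ⟨w, rfl⟩ := beta_surj Sinv hS1 hS2 v
  refine ⟨w, ?_⟩
  induction w with
  | zero => simp
  | add a b ha hb => simp only [map_add, ha, hb]
  | tmul a x => rw [rhat_tmul, rhat_tmul, rhat_mulRight, theta_eq]
end theta
end Aux

section Aux2
open LinearMap

variable {k H : Type} [Field k] [CommRing H] [HopfAlgebra k H]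

lemma exists_repr2 {M N : Type} [AddCommGroup M] [Module k M] [AddCommGroup N] [Module k N]
    (x : M ⊗[k] N) : ∃ (n : ℕ) (a : ℕ → M) (b : ℕ → N),
      ∑ i ∈ Finset.range n, a i ⊗ₜ[k] b i = x := by
  induction x with
  | zero => exact ⟨0, fun _ => 0, fun _ => 0, by simp⟩
  | tmul m y => exact ⟨1, fun _ => m, fun _ => y, by simp⟩
  | add x y hx hy =>
    obtain ⟨n, a, b, rfl⟩ := hx
    obtain ⟨n', a', b', rfl⟩ := hy
    refine ⟨n + n', fun i => if i < n then a i else a' (i - n),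
      fun i => if i < n then b i else b' (i - n), ?_⟩
    rw [Finset.sum_range_add]
    congr 1
    · refine Finset.sum_congr rfl fun i hi => ?_
      simp [Finset.mem_range.1 hi]
    · refine Finset.sum_congr rfl fun i hi => ?_
      simp

lemma exists_repr3 (x : (H ⊗[k] H) ⊗[k] H) : ∃ (n : ℕ) (a b c : ℕ → H),
      ∑ i ∈ Finset.range n, (a i ⊗ₜ[k] b i) ⊗ₜ[k] c i = x := by
  induction x with
  | zero => exact ⟨0, fun _ => 0, fun _ => 0, fun _ => 0, by simp⟩
  | tmul m y =>
    obtain ⟨n, a, b, rfl⟩ := exists_repr2 m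
    exact ⟨n, a, b, fun _ => y, by simp [TensorProduct.sum_tmul]⟩
  | add x y hx hy =>
    obtain ⟨n, a, b, c, rfl⟩ := hx
    obtain ⟨n', a', b', c', rfl⟩ := hy
    refine ⟨n + n', fun i => if i < n then a i else a' (i - n),
      fun i => if i < n then b i else b' (i - n), fun i => if i < n then c i else c' (i - n), ?_⟩
    rw [Finset.sum_range_add]
    congr 1
    · refine Finset.sum_congr rfl fun i hi => ?_
      simp [Finset.mem_range.1 hi]
    · refine Finset.sum_congr rfl fun i hi => ?_
      simp

section compat
variable (Sinv : H →ₗ[k] H)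
variable {M : Type} [AddCommGroup M] [Module k M] [Module H M] [IsScalarTower k H M]
  [SMulCommClass H k M] {ρ : M →ₗ[k] M ⊗[k] H}

lemma compat_iff : IsYDCompat k H Sinv ρ ↔
    ∀ (h : H) (m : M), ρ (h • m) = act M (theta Sinv h) (ρ m) := by
  have key : ∀ (h : H) (m : M) (s t : Finset ℕ) (a b c : ℕ → H) (m₀ : ℕ → M) (m₁ : ℕ → H),
    (∑ i ∈ s, (a i ⊗ₜ[k] b i) ⊗ₜ[k] c i) = Delta2 k H h →
    (∑ j ∈ t, m₀ j ⊗ₜ[k] m₁ j) = ρ m → act M (theta Sinv h) (ρ m) =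
    ∑ i ∈ s, ∑ j ∈ t, (b i • m₀ j) ⊗ₜ[k] (c i * m₁ j * Sinv (a i)) := by
    intro h m s t a b c m₀ m₁ h1 h2
    simp only [theta, comp_apply]
    rw [← h1, ← h2]
    simp only [map_sum, thetaAux_tmul, LinearMap.sum_apply, act_tmul]
    rw [Finset.sum_comm]
    refine Finset.sum_congr rfl fun i _ => Finset.sum_congr rfl fun j _ => ?_
    rw [mul_right_comm]
  constructor
  · intro hc h m
    obtain ⟨s, a, b, c, h1⟩ := exists_repr3 (Delta2 k H h)
    obtain ⟨t, m₀, m₁, h2⟩ := exists_repr2 (ρ m)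
    rw [key h m _ _ a b c m₀ m₁ h1 h2]
    exact hc h m _ _ a b c m₀ m₁ h1 h2
  · intro hc h m s t a b c m₀ m₁ h1 h2
    rw [hc, key h m _ _ a b c m₀ m₁ h1 h2]

lemma mulRight_eq_act (y : H) (u : M ⊗[k] H) :
    lTensor M (mulRight k y) u = act M (1 ⊗ₜ[k] y) u := by
  induction u with
  | zero => simp
  | add a b ha hb => simp only [map_add, ha, hb]
  | tmul a x => simp [mul_comm]

lemma rhat_act (hc : IsYDCompat k H Sinv ρ) (w : H ⊗[k] H) (u : M ⊗[k] H) :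
    rhat ρ (act M w u) = act M (rhat (theta Sinv) w) (rhat ρ u) := by
  rw [compat_iff] at hc
  induction w with
  | zero => simp
  | add a b ha hb => simp only [map_add, ha, hb, LinearMap.add_apply]
  | tmul h x =>
    induction u with
    | zero => simp
    | add a b ha hb => simp only [map_add, ha, hb]
    | tmul m y =>
      rw [act_tmul, rhat_tmul, rhat_tmul, rhat_tmul, hc, mulRight_eq_act, mulRight_eq_act,
        mulRight_eq_act]
      have : ∀ z : H ⊗[k] H, act H (1 ⊗ₜ[k] x) z = (1 ⊗ₜ[k] x) * z := by
        intro z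
        induction z with
        | zero => simp
        | add a b ha hb => simp only [map_add, ha, hb, mul_add]
        | tmul a b => simp
      rw [this, ← Module.End.mul_apply, ← Module.End.mul_apply, ← map_mul, ← map_mul]
      congr 2
      rw [mul_right_comm, Algebra.TensorProduct.tmul_mul_tmul, mul_one]
end compat

section transfer
variable (Sinv : H →ₗ[k] H)
variable {M N : Type} [AddCommGroup M] [Module k M] 
  [AddCommGroup N] [Module k N]  {ρ : M →ₗ[k] M ⊗[k] H} {ρN : N →ₗ[k] N ⊗[k] H}

lemma assoc_rTensor (ι : M →ₗ[k] N) (z : (M ⊗[k] H) ⊗[k] H) :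
    TensorProduct.assoc k N H H (rTensor H (rTensor H ι) z) =
      rTensor (H ⊗[k] H) ι (TensorProduct.assoc k M H H z) := by
  have : (TensorProduct.assoc k N H H).toLinearMap ∘ₗ (rTensor H (rTensor H ι)) =
    rTensor (H ⊗[k] H) ι ∘ₗ (TensorProduct.assoc k M H H).toLinearMap := by
    ext; simp
  exact congr($this z)

lemma comod_of_inj (ι : M →ₗ[k] N) (hι : Function.Injective ι)
    (h : ρN.comp ι = (rTensor H ι).comp ρ) (hN : IsComod k H ρN) : IsComod k H ρ := by
  have h' : ∀ m, ρN (ι m) = rTensor H ι (ρ m) := fun m => congr($h m)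
  constructor
  · intro m
    apply hι
    have h1 := hN.1 (ι m)
    rw [h'] at h1
    rw [← h1]
    generalize ρ m = u
    induction u with
    | zero => simp
    | add a b ha hb => simp only [map_add, ha, hb]
    | tmul a b => simp
  · intro m
    apply Module.Flat.rTensor_preserves_injective_linearMap (M := H ⊗[k] H) ι hι
    have h1 := hN.2 (ι m)
    rw [h', ← comp_apply, ← rTensor_comp, h, rTensor_comp, comp_apply, assoc_rTensor] at h1
    rw [h1, ← comp_apply (lTensor _ _), lTensor_comp_rTensor, ← comp_apply (rTensor _ _),
      rTensor_comp_lTensor]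

lemma compat_of_inj [Module H M] [IsScalarTower k H M] [SMulCommClass H k M] [Module H N]
    [IsScalarTower k H N] [SMulCommClass H k N]
    (ι : M →ₗ[k] N) (hι : Function.Injective ι) (hl : ∀ (h : H) (m : M), ι (h • m) = h • ι m)
    (h : ρN.comp ι = (rTensor H ι).comp ρ) (hN : IsYDCompat k H Sinv ρN) :
    IsYDCompat k H Sinv ρ := by
  have h' : ∀ m, ρN (ι m) = rTensor H ι (ρ m) := fun m => congr($h m)
  rw [compat_iff] at hN ⊢
  intro x m
  apply Module.Flat.rTensor_preserves_injective_linearMap (M := H) ι hι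
  rw [← h', hl, hN, h', act_rTensor _ hl]

lemma exists_kernel (B C : YDCat k H Sinv) (g : B.M →ₗ[k] C.M) (hg : IsHom k H B.ρ C.ρ g)
    (hs : Function.Surjective g) : ∃ (K : YDCat k H Sinv) (f : K.M →ₗ[k] B.M),
      IsHom k H K.ρ B.ρ f ∧ Function.Injective f ∧ range f = ker g := by
  let g' : B.M →ₗ[H] C.M := { toFun := g, map_add' := map_add g, map_smul' := hg.1 }
  let ι : ker g' →ₗ[k] B.M := (ker g').subtype.restrictScalars k
  have hι : Function.Injective ι := Subtype.val_injective
  have hr : range ι = ker g := by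
    ext x
    constructor
    · rintro ⟨y, rfl⟩
      exact y.2
    · intro hx
      exact ⟨⟨x, hx⟩, rfl⟩
  have hex : Function.Exact ι g := LinearMap.exact_iff.2 hr.symm
  have hex2 := rTensor_exact H hex hs
  have hi2 : Function.Injective (rTensor H ι) :=
    Module.Flat.rTensor_preserves_injective_linearMap (M := H) ι hι
  have hmem : ∀ m : ker g', (B.ρ.comp ι) m ∈ range (rTensor H ι) := by
    intro m
    rw [← LinearMap.exact_iff.1 hex2, mem_ker]
    have := congr($(hg.2) (ι m))
    simp only [comp_apply] at this
    rw [comp_apply, ← this]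
    have : g (ι m) = 0 := m.2
    rw [this, map_zero]
  let ρK : ker g' →ₗ[k] (ker g') ⊗[k] H :=
    (LinearEquiv.ofInjective _ hi2).symm.toLinearMap ∘ₗ (B.ρ.comp ι).codRestrict _ hmem
  have hρ : B.ρ.comp ι = (rTensor H ι).comp ρK := by
    ext m
    have := LinearEquiv.apply_symm_apply (LinearEquiv.ofInjective _ hi2)
      ((B.ρ.comp ι).codRestrict _ hmem m)
    have := congr(($this : B.M ⊗[k] H))
    exact this.symm
  exact ⟨{ M := ker g', ρ := ρK, comod := comod_of_inj ι hι hρ B.comod,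
           compat := compat_of_inj Sinv ι hι (fun _ _ => rfl) hρ B.compat }, ι,
    ⟨fun _ _ => rfl, hρ⟩, hι, hr⟩
end transfer
end Aux2

section Aux3
set_option linter.unusedSectionVars false
open LinearMap

variable {k H : Type} [Field k] [CommRing H] [HopfAlgebra k H]
variable {A N : Type} [AddCommGroup A] [Module k A] [Module H A]
  [IsScalarTower k H A] [SMulCommClass H k A]
  [AddCommGroup N] [Module k N] [Module H N] [IsScalarTower k H N] [SMulCommClass H k N]

variable (k H A N) in
/-- Evaluation pairing. -/
def evB : (A →ₗ[H] N) →ₗ[k] A →ₗ[k] N :=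
  LinearMap.mk₂ k (fun f a => f a) (fun _ _ _ => rfl) (fun _ _ _ => rfl)
    (fun f => map_add f) (fun c f a => by
      rw [← IsScalarTower.algebraMap_smul H c a, map_smul, IsScalarTower.algebraMap_smul])

@[simp] lemma evB_apply (f : A →ₗ[H] N) (a : A) : evB k H A N f a = f a := rfl

section W
variable {W : Type} [CommRing W] [Algebra k W]

/-- `(f ⊗ x, a ⊗ y) ↦ f(a) ⊗ xy`. -/
def pr : (A →ₗ[H] N) ⊗[k] W →ₗ[k] A ⊗[k] W →ₗ[k] N ⊗[k] W :=
  TensorProduct.map₂ (evB k H A N) (LinearMap.mul k W)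

@[simp] lemma pr_tmul (f : A →ₗ[H] N) (x : W) (a : A) (y : W) :
    pr (f ⊗ₜ[k] x) (a ⊗ₜ[k] y) = f a ⊗ₜ[k] (x * y) := rfl

lemma pr_one (z : (A →ₗ[H] N) ⊗[k] W) (a : A) :
    pr z (a ⊗ₜ[k] 1) = rTensor W (evalAtH (k := k) a) z := by
  induction z with
  | zero => simp
  | add x y hx hy => simp only [map_add, hx, hy, LinearMap.add_apply]
  | tmul f x => simp [evalAtH]

lemma pr_mulRight (z : (A →ₗ[H] N) ⊗[k] W) (u : A ⊗[k] W) (w : W) :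
    pr z (lTensor A (mulRight k w) u) = lTensor N (mulRight k w) (pr z u) := by
  induction z with
  | zero => simp
  | add x y hx hy => simp only [map_add, hx, hy, LinearMap.add_apply]
  | tmul f x =>
    induction u with
    | zero => simp
    | add x y hx hy => simp only [map_add, hx, hy]
    | tmul a y => simp [mul_assoc]

lemma equiv_rTensor {ι P : Type} [DecidableEq ι] [AddCommGroup P] [Module k P] (b : Module.Basis ι k W) 
    (f : P →ₗ[k] N) (z : P ⊗[k] W) (i : ι) :
    TensorProduct.equivFinsuppOfBasisRight b (rTensor W f z) i =
      f (TensorProduct.equivFinsuppOfBasisRight b z i) := by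
  induction z with
  | zero => simp
  | add x y hx hy => simp only [map_add, hx, hy, Finsupp.add_apply]
  | tmul f x => simp [TensorProduct.equivFinsuppOfBasisRight_apply_tmul_apply]

lemma eval_inj (z z' : (A →ₗ[H] N) ⊗[k] W)
    (h : ∀ a, rTensor W (evalAtH (k := k) a) z = rTensor W (evalAtH (k := k) a) z') : z = z' := by
  classical
  let b := Module.Basis.ofVectorSpace k W
  apply (TensorProduct.equivFinsuppOfBasisRight b).injective
  ext i a
  have := congr(TensorProduct.equivFinsuppOfBasisRight b $(h a) i)
  rw [equiv_rTensor, equiv_rTensor] at this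
  exact this

lemma exists_of_fg [Module.Finite H A] (φ : A →ₗ[k] N ⊗[k] W)
    (hφ : ∀ (h : H) (a : A), φ (h • a) = rTensor W (smulMap k H h) (φ a)) :
    ∃ z : (A →ₗ[H] N) ⊗[k] W, ∀ a, rTensor W (evalAtH (k := k) a) z = φ a := by
  classical
  let b := Module.Basis.ofVectorSpace k W
  let e := TensorProduct.equivFinsuppOfBasisRight (M := N) b
  let c : Module.Basis.ofVectorSpaceIndex k W → (A →ₗ[H] N) := fun i =>
    { toFun := fun a => e (φ a) i
      map_add' := fun a a' => by simp
      map_smul' := fun h a => by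
        rw [hφ]
        exact equiv_rTensor b (smulMap k H h) _ _ }
  obtain ⟨S, hS⟩ := (Module.Finite.fg_top : (⊤ : Submodule H A).FG)
  let s := S.biUnion fun a => (e (φ a)).support
  have hc : ∀ i, i ∉ s → c i = 0 := by
    intro i hi
    apply LinearMap.ext_on hS
    intro a ha
    by_contra hne
    exact hi (Finset.mem_biUnion.2 ⟨a, ha, Finsupp.mem_support_iff.2 hne⟩)
  refine ⟨∑ i ∈ s, c i ⊗ₜ b i, fun a => ?_⟩
  apply e.injective
  ext i
  have : e (rTensor W (evalAtH (k := k) a) (∑ i ∈ s, c i ⊗ₜ b i)) i = c i a := by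
    simp only [map_sum, rTensor_tmul, Finsupp.finsetSum_apply, e,
      TensorProduct.equivFinsuppOfBasisRight_apply_tmul_apply, Module.Basis.repr_self]
    by_cases hi : i ∈ s
    · rw [Finset.sum_eq_single i]
      · simp [evalAtH]
      · intro j _ hj
        simp [hj]
      · exact fun h => absurd hi h
    · rw [hc i hi]
      apply Finset.sum_eq_zero
      intro j hj
      have : j ≠ i := fun h => hi (h ▸ hj)
      simp [this]
  exact this
end W

section coact
variable {ρA : A →ₗ[k] A ⊗[k] H} {ρN : N →ₗ[k] N ⊗[k] H}

lemma pr_inj (hA : IsComod k H ρA) (z z' : (A →ₗ[H] N) ⊗[k] H)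
    (h : ∀ a, pr z (ρA a) = pr z' (ρA a)) : z = z' := by
  apply eval_inj
  intro a
  rw [← pr_one, ← pr_one]
  obtain ⟨v, hv⟩ := rhat_surj hA (a ⊗ₜ 1)
  rw [← hv]
  clear hv
  induction v with
  | zero => simp
  | add x y hx hy => simp only [map_add, hx, hy]
  | tmul f x => rw [rhat_tmul, pr_mulRight, pr_mulRight, h]

lemma lT_mulRight (y : H) (u : A ⊗[k] H) :
    lTensor A (Coalgebra.comul (R := k) (A := H)) (lTensor A (mulRight k y) u) =
    lTensor A (mulRight k (Coalgebra.comul (R := k) (A := H) y))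
      (lTensor A (Coalgebra.comul (R := k) (A := H)) u) := by
  induction u with
  | zero => simp
  | add x y hx hy => simp only [map_add, hx, hy]
  | tmul f x => simp

lemma pr_inj2 (hA : IsComod k H ρA) (z z' : (A →ₗ[H] N) ⊗[k] (H ⊗[k] H))
    (h : ∀ a, pr z (lTensor A (Coalgebra.comul (R := k) (A := H)) (ρA a)) =
      pr z' (lTensor A (Coalgebra.comul (R := k) (A := H)) (ρA a))) : z = z' := by
  apply eval_inj
  intro a
  rw [← pr_one, ← pr_one]
  obtain ⟨v, hv⟩ := rhat_surj hA (a ⊗ₜ 1)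
  have hv2 : (a ⊗ₜ[k] (1 : H ⊗[k] H)) =
      lTensor A (Coalgebra.comul (R := k) (A := H)) (rhat ρA v) := by
    rw [hv]; simp
  rw [hv2]
  clear hv hv2
  induction v with
  | zero => simp
  | add x y hx hy => simp only [map_add, hx, hy]
  | tmul f x => rw [rhat_tmul, lT_mulRight, pr_mulRight, pr_mulRight, h]

variable (Sinv : H →ₗ[k] H)

lemma sig_smul (hS1 : ∀ h : H, Sinv (HopfAlgebra.antipode (R := k) (A := H) h) = h)
    (hS2 : ∀ h : H, HopfAlgebra.antipode (R := k) (A := H) (Sinv h) = h)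
    (hA : IsComod k H ρA) (cA : IsYDCompat k H Sinv ρA) (h : H) :
    ∃ w, rhat (theta (k := k) Sinv) w = h ⊗ₜ 1 ∧ ∀ a, sig ρA (h • a) = act A w (sig ρA a) := by
  obtain ⟨w, hw⟩ := theta_surj Sinv hS1 hS2 (h ⊗ₜ 1)
  refine ⟨w, hw, fun a => ?_⟩
  rw [← sighat_rhat hA (act A w (sig ρA a)), rhat_act Sinv cA, hw, rhat_sig hA, act_tmul, mul_one,
    rhat_one]

lemma exists_coact [Module.Finite H A]
    (hS1 : ∀ h : H, Sinv (HopfAlgebra.antipode (R := k) (A := H) h) = h)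
    (hS2 : ∀ h : H, HopfAlgebra.antipode (R := k) (A := H) (Sinv h) = h)
    (hA : IsComod k H ρA) (cA : IsYDCompat k H Sinv ρA) (cN : IsYDCompat k H Sinv ρN)
    (f : A →ₗ[H] N) :
    ∃ z : (A →ₗ[H] N) ⊗[k] H, ∀ a, pr z (ρA a) = ρN (f a) := by
  let T : A →ₗ[k] N ⊗[k] H := rhat ρN ∘ₗ rTensor H (evB k H A N f) ∘ₗ sig ρA
  have hT : ∀ (h : H) (a : A), T (h • a) = rTensor H (smulMap k H h) (T a) := by
    intro h a
    obtain ⟨w, hw, hw2⟩ := sig_smul Sinv hS1 hS2 hA cA h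
    have e : ∀ u : N ⊗[k] H, rTensor H (smulMap k H h) u = act N (h ⊗ₜ 1) u := by
      intro u
      induction u with
      | zero => simp
      | add x y hx hy => simp only [map_add, hx, hy]
      | tmul f x => simp [smulMap]
    simp only [T, comp_apply]
    rw [hw2, act_rTensor _ (fun h m => map_smul f h m), rhat_act Sinv cN, hw, e]
  obtain ⟨z, hz⟩ := exists_of_fg T hT
  refine ⟨z, fun a => ?_⟩
  have key : ∀ u, pr z u = rhat ρN (rTensor H (evB k H A N f) (rhat (sig ρA) u)) := by
    intro u
    induction u with
    | zero => simp
    | add x y hx hy => simp only [map_add, hx, hy]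
    | tmul a y =>
      have : a ⊗ₜ[k] y = lTensor A (mulRight k y) (a ⊗ₜ 1) := by simp
      have e : ∀ u, rTensor H (evB k H A N f) (lTensor A (mulRight k y) u) =
          lTensor N (mulRight k y) (rTensor H (evB k H A N f) u) := by
        intro u
        induction u with
        | zero => simp
        | add x y hx hy => simp only [map_add, hx, hy]
        | tmul f x => simp
      rw [this, pr_mulRight, pr_one, hz, rhat_mulRight, rhat_one, e, rhat_mulRight]
      rfl
  rw [key, sighat_rho hA, rTensor_tmul, rhat_one]
  rfl
end coact

section bundle
variable (Sinv : H →ₗ[k] H)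

lemma exists_homYD (hS1 : ∀ h : H, Sinv (HopfAlgebra.antipode (R := k) (A := H) h) = h)
    (hS2 : ∀ h : H, HopfAlgebra.antipode (R := k) (A := H) (Sinv h) = h)
    (A N : YDCat k H Sinv) (hfin : Module.Finite H A.M) :
    ∃ ρQ : (A.M →ₗ[H] N.M) →ₗ[k] (A.M →ₗ[H] N.M) ⊗[k] H,
      IsComod k H ρQ ∧ IsYDCompat k H Sinv ρQ ∧
      ∀ f a, pr (ρQ f) (A.ρ a) = N.ρ (f a) := by
  choose r hr using exists_coact (N := N.M) Sinv hS1 hS2 A.comod A.compat N.compat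
  let ρQ : (A.M →ₗ[H] N.M) →ₗ[k] (A.M →ₗ[H] N.M) ⊗[k] H :=
    { toFun := r
      map_add' := fun f g => by
        apply pr_inj A.comod
        intro a
        simp [hr]
      map_smul' := fun c f => by
        apply pr_inj A.comod
        intro a
        simp [hr] }
  have hρ : ∀ f a, pr (ρQ f) (A.ρ a) = N.ρ (f a) := hr
  refine ⟨ρQ, ⟨fun f => ?_, fun f => ?_⟩, ?_, hρ⟩
  · ext a
    have h1 := N.comod.1 (f a)
    rw [← hρ f a] at h1
    rw [← h1]
    have key : ∀ (z : (A.M →ₗ[H] N.M) ⊗[k] H) (u : A.M ⊗[k] H),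
        (TensorProduct.rid k N.M) (lTensor N.M (Coalgebra.counit (R := k) (A := H)) (pr z u)) =
        (TensorProduct.rid k _ (lTensor _ (Coalgebra.counit (R := k) (A := H)) z))
          (TensorProduct.rid k A.M (lTensor A.M (Coalgebra.counit (R := k) (A := H)) u)) := by
      intro z u
      induction z with
      | zero => simp
      | add x y hx hy => simp only [map_add, hx, hy, LinearMap.add_apply]
      | tmul f x =>
        induction u with
        | zero => simp
        | add x y hx hy => simp only [map_add, hx, hy]
        | tmul a y =>
          have := (evB k H A.M N.M f).map_smul
          simp only [evB_apply] at this
          simp [this, mul_smul]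
    rw [key, A.comod.1]
  · apply pr_inj2 A.comod
    intro a
    have k1 : ∀ (z : (A.M →ₗ[H] N.M) ⊗[k] H) (u : A.M ⊗[k] H),
        pr (lTensor _ (Coalgebra.comul (R := k) (A := H)) z)
          (lTensor _ (Coalgebra.comul (R := k) (A := H)) u) =
        lTensor _ (Coalgebra.comul (R := k) (A := H)) (pr z u) := by
      intro z u
      induction z with
      | zero => simp
      | add x y hx hy => simp only [map_add, hx, hy, LinearMap.add_apply]
      | tmul f x =>
        induction u with
        | zero => simp
        | add x y hx hy => simp only [map_add, hx, hy]
        | tmul a y => simp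
    have k0 : ∀ (z : (A.M →ₗ[H] N.M) ⊗[k] H) (u : A.M ⊗[k] H) (x y : H),
        pr (TensorProduct.assoc k _ H H (z ⊗ₜ x)) (TensorProduct.assoc k _ H H (u ⊗ₜ y)) =
        TensorProduct.assoc k _ H H (pr z u ⊗ₜ (x * y)) := by
      intro z u x y
      induction z with
      | zero => simp
      | add x y hx hy => simp only [map_add, hx, hy, LinearMap.add_apply, TensorProduct.add_tmul]
      | tmul f x =>
        induction u with
        | zero => simp
        | add x y hx hy => simp only [map_add, hx, hy, TensorProduct.add_tmul]
        | tmul a y => simp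
    have k2 : ∀ (z : (A.M →ₗ[H] N.M) ⊗[k] H) (u : A.M ⊗[k] H),
        pr (TensorProduct.assoc k _ H H (rTensor H ρQ z))
          (TensorProduct.assoc k _ H H (rTensor H A.ρ u)) =
        TensorProduct.assoc k _ H H (rTensor H N.ρ (pr z u)) := by
      intro z u
      induction z with
      | zero => simp
      | add x y hx hy => simp only [map_add, hx, hy, LinearMap.add_apply]
      | tmul f x =>
        induction u with
        | zero => simp
        | add x y hx hy => simp only [map_add, hx, hy]
        | tmul a y => rw [rTensor_tmul, rTensor_tmul, k0, hρ, pr_tmul, rTensor_tmul]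
    rw [k1, ← A.comod.2 a, k2, hρ, N.comod.2]
  · rw [compat_iff]
    intro h f
    apply pr_inj A.comod
    intro a
    have hc := (compat_iff Sinv).1 N.compat h (f a)
    have key : ∀ (w : H ⊗[k] H) (z : (A.M →ₗ[H] N.M) ⊗[k] H) (u : A.M ⊗[k] H),
        pr (act _ w z) u = act N.M w (pr z u) := by
      intro w z u
      induction w with
      | zero => simp
      | add x y hx hy => simp only [map_add, hx, hy, LinearMap.add_apply]
      | tmul h y =>
        induction z with
        | zero => simp
        | add x y hx hy => simp only [map_add, hx, hy, LinearMap.add_apply]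
        | tmul f x =>
          induction u with
          | zero => simp
          | add x y hx hy => simp only [map_add, hx, hy]
          | tmul a y => simp [mul_assoc]
    rw [key, hρ, hρ, ← hc]
    rfl
end bundle
end Aux3

/-- Proposition 3.1. Let `k` be a field and `H` a commutative Hopf
algebra over `k` with bijective antipode. If the category of Yetter-Drinfeld modules
satisfies condition (†) and the coinvariants functor is exact on Yetter-Drinfeld
modules, then every Yetter-Drinfeld module which is finitely generated as a left
`H`-module is a projective object in the category of Yetter-Drinfeld modules. -/
theorem fg_YetterDrinfeld_projective_of_dagger_and_coinvariants_exact
    (k H : Type) [Field k] [CommRing H] [HopfAlgebra k H]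
    (Sinv : H →ₗ[k] H)
    (hS1 : ∀ h : H, Sinv (HopfAlgebra.antipode (R := k) (A := H) h) = h)
    (hS2 : ∀ h : H, HopfAlgebra.antipode (R := k) (A := H) (Sinv h) = h)
    (hdagger : DaggerYD k H Sinv)
    (hcoinv : CoinvExactYD k H Sinv) :
    ∀ A : YDCat k H Sinv, Module.Finite H A.M → IsProjectiveYD k H Sinv A := by
  intro A hfin B C g f hg hs hf
  obtain ⟨K, ι, hι, hιi, hιr⟩ := exists_kernel Sinv B C g hg hs
  obtain ⟨-, -, hsurj⟩ := hdagger A hfin K B C ι g hι hg hιi hs hιr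
  obtain ⟨ρB, cB, yB, hB⟩ := exists_homYD Sinv hS1 hS2 A B hfin
  obtain ⟨ρC, cC, yC, hC⟩ := exists_homYD Sinv hS1 hS2 A C hfin
  let QB : YDCat k H Sinv := { M := A.M →ₗ[H] B.M, ρ := ρB, comod := cB, compat := yB }
  let QC : YDCat k H Sinv := { M := A.M →ₗ[H] C.M, ρ := ρC, comod := cC, compat := yC }
  let G : QB.M →ₗ[k] QC.M := postcompH (X := A.M) g hg.1
  have hgρ : ∀ b, C.ρ (g b) = LinearMap.rTensor H g (B.ρ b) := fun b => congr($(hg.2) b)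
  have hG : IsHom k H QB.ρ QC.ρ G := by
    refine ⟨fun h φ => ?_, ?_⟩
    · apply LinearMap.ext
      intro a
      exact hg.1 h (φ a)
    · apply LinearMap.ext
      intro φ
      apply pr_inj A.comod
      intro a
      have key : ∀ (z : (A.M →ₗ[H] B.M) ⊗[k] H) (u : A.M ⊗[k] H),
          pr (LinearMap.rTensor H (postcompH (X := A.M) g hg.1) z) u =
            LinearMap.rTensor H g (pr z u) := by
        intro z u
        induction z with
        | zero => simp
        | add x y hx hy => simp only [map_add, hx, hy, LinearMap.add_apply]
        | tmul f x =>
          induction u with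
          | zero => simp
          | add x y hx hy => simp only [map_add, hx, hy]
          | tmul a y => simp [postcompH]
      refine (hC _ a).trans ?_
      refine Eq.trans ?_ (key (ρB φ) (A.ρ a)).symm
      rw [hB]
      exact hgρ (φ a)
  obtain ⟨K2, ι2, hι2, hιi2, hιr2⟩ := exists_kernel Sinv QB QC G hG hsurj
  obtain ⟨-, -, hsurj2⟩ := hcoinv K2 QB QC ι2 G hι2 hG hιi2 hsurj hιr2
  -- the coinvariants of `Hom_H(A, N)` are the colinear maps
  have key : ∀ (N : Type) [AddCommGroup N] [Module k N] [Module H N] [IsScalarTower k H N]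
      [SMulCommClass H k N] (φ : A.M →ₗ[H] N) (u : A.M ⊗[k] H),
      pr (φ ⊗ₜ[k] (1 : H)) u = LinearMap.rTensor H (evB k H A.M N φ) u := by
    intro N _ _ _ _ _ φ u
    induction u with
    | zero => simp
    | add x y hx hy => simp only [map_add, hx, hy]
    | tmul a y => simp
  let f' : A.M →ₗ[H] C.M := { toFun := f, map_add' := map_add f, map_smul' := hf.1 }
  have hff : evB k H A.M C.M f' = f := by ext; rfl
  have hf' : f' ∈ coinv ρC := by
    rw [mem_coinv]
    apply pr_inj A.comod
    intro a
    rw [hC, key, hff]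
    exact congr($(hf.2) a)
  obtain ⟨⟨l, hl⟩, hl2⟩ := hsurj2 ⟨f', hf'⟩
  have hl3 : G l = f' := congrArg Subtype.val hl2
  have hl' : ρB l = l ⊗ₜ[k] (1 : H) := mem_coinv.1 hl
  refine ⟨evB k H A.M B.M l, ⟨fun h a => LinearMap.map_smul l h a, ?_⟩, ?_⟩
  · ext a
    have := hB l a
    rw [hl', key] at this
    exact this.symm
  · ext a
    exact congr($hl3 a)
end YDPaper
end
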